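/- arXiv:2407.03170 — 2 statements merged into one kernel-verified Lean document; each statement's English description precedes it below -/
import Mathlib

section
/- Over F_{3^6}, with α a primitive element of F_{3^6} and β = α^{91} (a primitive element of F_{3^2}), the trinomial F(x) = β x^{30} + x^{10} + x^2 is planar. -/
instance : Fact (Nat.Prime 3) := ⟨by norm_num⟩

/-- The field with nine elements, in its decidable model `𝔽₃[i]`. -/
abbrev NineField := QuadraticAlgebra (ZMod 3) (-1) 0

instance : Fintype NineField :=
  Fintype.ofEquiv _ (QuadraticAlgebra.equivProd (-1 : ZMod 3) 0).symm

theorem NineField.exists_mul_eq_one : ∀ z : NineField, z ≠ 0 → ∃ w, z * w = 1 := by decide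

theorem fixed_cube {M : Type*} [Monoid M] {x : M} (hx : x ^ 9 = x) : (x ^ 3) ^ 9 = x ^ 3 := by
  rw [← pow_mul, mul_comm, pow_mul, hx]

section CharThree

variable {F : Type*} [Field F] [CharP F 3]

theorem add_pow_nine (x y : F) : (x + y) ^ 9 = x ^ 9 + y ^ 9 :=
  add_pow_char_pow x y (p := 3) (n := 2)

theorem sub_pow_nine (x y : F) : (x - y) ^ 9 = x ^ 9 - y ^ 9 :=
  sub_pow_char_pow x y (p := 3) (n := 2)

/-- In characteristic three, a square root of `-1` gives an embedding of the field with nine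
elements whose image is the set of fixed points of `x ↦ x ^ 9`. -/
theorem exists_nineField_hom {i : F} (hi : i ^ 2 = -1) :
    ∃ f : NineField →+* F, Function.Injective f ∧ ∀ x : F, x ^ 9 = x → ∃ z, f z = x := by
  let := ZMod.algebra F 3
  let f : NineField →ₐ[ZMod 3] F :=
    QuadraticAlgebra.lift ⟨i, by rw [← pow_two, hi]; simp⟩
  have hfi : f ⟨0, 1⟩ = i := by simp [f, QuadraticAlgebra.lift]
  refine ⟨f, (injective_iff_map_eq_zero f).2 fun z hz ↦ ?_, fun x hx ↦ ?_⟩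
  · by_contra h
    obtain ⟨w, hw⟩ := NineField.exists_mul_eq_one z h
    simpa [hz] using congrArg f hw
  · have key : (x * (x - 1) * (x + 1)) * ((x - i) * (x - i - 1) * (x - i + 1)) *
        ((x + i) * (x + i - 1) * (x + i + 1)) = 0 := by grind
    simp only [mul_eq_zero] at key
    rcases key with (((h | h) | h) | ((h | h) | h)) | ((h | h) | h)
    · exact ⟨0, by simp [h]⟩
    · exact ⟨1, by rw [RingHom.coe_coe, map_one]; grind⟩
    · exact ⟨-1, by rw [RingHom.coe_coe, map_neg, map_one]; grind⟩
    · exact ⟨⟨0, 1⟩, by rw [RingHom.coe_coe, hfi]; grind⟩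
    · exact ⟨⟨0, 1⟩ + 1, by rw [RingHom.coe_coe, map_add, map_one, hfi]; grind⟩
    · exact ⟨⟨0, 1⟩ - 1, by rw [RingHom.coe_coe, map_sub, map_one, hfi]; grind⟩
    · exact ⟨-⟨0, 1⟩, by rw [RingHom.coe_coe, map_neg, hfi]; grind⟩
    · exact ⟨-⟨0, 1⟩ + 1, by rw [RingHom.coe_coe, map_add, map_neg, map_one, hfi]; grind⟩
    · exact ⟨-⟨0, 1⟩ - 1, by rw [RingHom.coe_coe, map_sub, map_neg, map_one, hfi]; grind⟩

set_option maxRecDepth 100000 in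
theorem NineField.linear_obstruction : ∀ g : NineField, g ^ 4 = -1 → ∀ k : NineField,
    k ^ 3 + 1 - g + g * k = 0 → (k + 1 - g) + (k + 1 - g) ^ 3 ≠ 1 := by decide

set_option maxRecDepth 100000 in
theorem NineField.quadratic_obstruction : ∀ P : NineField, P ^ 4 = -1 → ∀ w : NineField,
    w ^ 3 + w + 1 = 0 → ∀ r k : NineField, k = -r ^ 2 - 1 - P →
      (w - k - P + w * P) ^ 2 ≠ r ^ 2 * (k ^ 2 - w - P * (1 + k ^ 3 + w + w ^ 2)) := by decide

/-- The field-level form of `NineField.linear_obstruction`. -/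
theorem linear_obstruction {g k : F} (hg : g ^ 4 = -1) (hk : k ^ 9 = k)
    (h : k ^ 3 + 1 - g + g * k = 0) : (k + 1 - g) + (k + 1 - g) ^ 3 ≠ 1 := by
  obtain ⟨f, hf, hr⟩ := exists_nineField_hom (i := g ^ 2) (by rw [← pow_mul, hg])
  obtain ⟨g, rfl⟩ := hr g (by linear_combination (g ^ 5 - g) * hg)
  obtain ⟨k, rfl⟩ := hr k hk
  have e := NineField.linear_obstruction g (hf (by simpa using hg)) k (hf (by simpa using h))
  exact fun h' ↦ e (hf (by simpa using h'))

/-- The field-level form of `NineField.quadratic_obstruction`. -/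
theorem quadratic_obstruction {P w r k : F} (hP : P ^ 4 = -1) (hw : w ^ 3 + w + 1 = 0)
    (hw' : w ^ 9 = w) (hr' : r ^ 9 = r) (hk : k = -r ^ 2 - 1 - P) :
    (w - k - P + w * P) ^ 2 ≠ r ^ 2 * (k ^ 2 - w - P * (1 + k ^ 3 + w + w ^ 2)) := by
  obtain ⟨f, hf, hr⟩ := exists_nineField_hom (i := P ^ 2) (by rw [← pow_mul, hP])
  obtain ⟨P, rfl⟩ := hr P (by linear_combination (P ^ 5 - P) * hP)
  obtain ⟨w, rfl⟩ := hr w hw'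
  obtain ⟨r, rfl⟩ := hr r hr'
  have e := NineField.quadratic_obstruction P (hf (by simpa using hP)) w
    (hf (by simpa using hw)) r _ rfl
  exact fun h' ↦ e (hf (by simpa [hk] using h'))

/-- An element moved by `1` under `x ↦ x ^ 9` satisfies no nontrivial quadratic relation over
the fixed field. -/
theorem quadratic_coeffs_eq_zero {m p q s : F} (hm : m ^ 9 = m - 1) (hp : p ^ 9 = p)
    (hq : q ^ 9 = q) (hs : s ^ 9 = s) (h : p * m ^ 2 + q * m + s = 0) :
    p = 0 ∧ q = 0 ∧ s = 0 := by
  have h1 : p * (m - 1) ^ 2 + q * (m - 1) + s = 0 := by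
    have := congrArg (· ^ 9) h
    simp only [add_pow_nine, mul_pow, ← pow_mul, hp, hq, hs] at this
    rw [mul_comm 2 9, pow_mul, hm] at this
    simpa using this
  have h2 : p * (m - 1 - 1) ^ 2 + q * (m - 1 - 1) + s = 0 := by
    have := congrArg (· ^ 9) h1
    simp only [add_pow_nine, sub_pow_nine, mul_pow, ← pow_mul, hp, hq, hs] at this
    rw [mul_comm 2 9, pow_mul, sub_pow_nine, hm] at this
    simpa using this
  have hp0 : p = 0 := by grind
  have hq0 : q = 0 := by grind
  exact ⟨hp0, hq0, by grind⟩

theorem add_cube (x y : F) : (x + y) ^ 3 = x ^ 3 + y ^ 3 := add_pow_char x y 3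

theorem sub_cube (x y : F) : (x - y) ^ 3 = x ^ 3 - y ^ 3 := sub_pow_char x y

/-- The case where both factors have nonzero trace to the fixed field. -/
theorem trace_one_obstruction {θ a x : F} (hθ : θ ^ 4 = -1) (ha : a + a ^ 9 + a ^ 81 = 1)
    (hx : x + x ^ 9 + x ^ 81 = 1) :
    a ^ 9 + x ^ 9 + a ^ 9 * x ^ 9 - a * x + θ * (a * x) ^ 3 ≠ 0 := by
  intro h
  have h3 : (3 : F) = 0 := by grind
  have hθ9 : θ ^ 9 = θ := by linear_combination (θ ^ 5 - θ) * hθ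
  have ha' : (a ^ 9) ^ 9 = 1 - a - a ^ 9 := by linear_combination ha
  have hx' : (x ^ 9) ^ 9 = 1 - x - x ^ 9 := by linear_combination hx
  obtain ⟨m, hm⟩ : ∃ m, m = a ^ 9 + x ^ 9 - a - x := ⟨_, rfl⟩
  obtain ⟨r, hr⟩ : ∃ r, r = a ^ 9 - x ^ 9 - a + x := ⟨_, rfl⟩
  obtain ⟨w, hw⟩ : ∃ w, w = m ^ 3 - m := ⟨_, rfl⟩
  obtain ⟨k, hk⟩ : ∃ k, k = a + x - m ^ 2 - m := ⟨_, rfl⟩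
  obtain ⟨l, hl⟩ : ∃ l, l = a - x + r * m := ⟨_, rfl⟩
  have hm9 : m ^ 9 = m - 1 := by
    rw [hm, sub_pow_nine, sub_pow_nine, add_pow_nine, ha', hx']; grind
  have hr9 : r ^ 9 = r := by
    rw [hr, add_pow_nine, sub_pow_nine, sub_pow_nine, ha', hx']; grind
  have hk9 : k ^ 9 = k := by
    rw [hk, sub_pow_nine, sub_pow_nine, add_pow_nine, pow_right_comm, hm9]; grind
  have hl9 : l ^ 9 = l := by
    rw [hl, add_pow_nine, sub_pow_nine, mul_pow, hm9, hr9]; grind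
  have hw9 : w ^ 9 = w := by
    rw [hw, sub_pow_nine, pow_right_comm, hm9, sub_cube]; ring
  have hw3 : w ^ 3 + w + 1 = 0 := by
    rw [hw, sub_cube, ← pow_mul, hm9]; ring
  obtain ⟨P, hP⟩ : ∃ P, P = -(1 + k + r ^ 2) := ⟨_, rfl⟩
  obtain ⟨Q, hQ⟩ : ∃ Q, Q = w - 1 - k - r * l := ⟨_, rfl⟩
  obtain ⟨R, hR⟩ : ∃ R, R = k ^ 2 - w - l ^ 2 := ⟨_, rfl⟩
  have hP9 : P ^ 9 = P := by
    rw [hP, neg_pow, add_pow_nine, add_pow_nine, pow_right_comm, hr9, hk9]; ring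
  have hQ9 : Q ^ 9 = Q := by
    rw [hQ, sub_pow_nine, sub_pow_nine, sub_pow_nine, mul_pow, hr9, hk9, hw9, hl9]; ring
  have hR9 : R ^ 9 = R := by
    rw [hR, sub_pow_nine, sub_pow_nine, pow_right_comm, pow_right_comm l, hk9, hw9, hl9]
  have hπ : a * x = P * m ^ 2 + Q * m + R := by
    have h1 : a = -(m ^ 2 + m + k + (l - r * m)) := by grind
    have h2 : x = -(m ^ 2 + m + k - (l - r * m)) := by grind
    have hm3 : m ^ 3 = m + w := by rw [hw]; ring
    rw [h1, h2, hP, hQ, hR]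
    linear_combination (m + 2) * hm3 + ((1 + k) * m ^ 2 + (1 + k + r * l) * m + w) * h3
  have hπ9 : a ^ 9 * x ^ 9 = P * (m - 1) ^ 2 + Q * (m - 1) + R := by
    rw [← mul_pow, hπ, add_pow_nine, add_pow_nine, mul_pow, mul_pow, pow_right_comm, hP9, hQ9,
      hR9, hm9]
  have hπ3 : (a * x) ^ 3 = P ^ 3 * (m + w) ^ 2 + Q ^ 3 * (m + w) + R ^ 3 := by
    have hm3 : m ^ 3 = m + w := by rw [hw]; ring
    rw [hπ, add_cube, add_cube, mul_pow, mul_pow, pow_right_comm, hm3]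
  have hcoeffs := quadratic_coeffs_eq_zero (p := 1 + θ * P ^ 3)
    (q := -1 + P + θ * (2 * w * P ^ 3 + Q ^ 3))
    (s := k + P - Q + θ * (w ^ 2 * P ^ 3 + w * Q ^ 3 + R ^ 3)) hm9
    (by simp only [add_pow_nine, mul_pow, fixed_cube hP9, hθ9]; ring)
    (by
      have h2 : (2 : F) = -1 := by grind
      simp only [h2, add_pow_nine, mul_pow, fixed_cube hP9, fixed_cube hQ9, hθ9, hP9, hw9]; ring)
    (by
      simp only [add_pow_nine, sub_pow_nine, mul_pow, fixed_cube hP9, fixed_cube hQ9,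
        fixed_cube hR9, pow_right_comm w 2, hθ9, hP9, hw9, hQ9, hk9])
    (by
      rw [hπ9, hπ3, hπ] at h
      have hρ : a ^ 9 + x ^ 9 = m ^ 2 + 2 * m + k := by rw [hk]; linear_combination -hm
      rw [hρ] at h
      linear_combination h - (1 - P) * m * h3)
  obtain ⟨e1, e2, e3⟩ := hcoeffs
  have hP4 : P ^ 4 = -1 := by
    have h1 : P ≠ 0 := by rintro rfl; simp at e1
    have h2 : (θ * P ^ 3) ^ 4 = 1 := by rw [eq_neg_of_add_eq_zero_right e1]; ring
    have h3 : P ^ 12 = -1 := by linear_combination P ^ 12 * hθ - h2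
    have h4 : P ^ 12 = P ^ 4 := by
      linear_combination P ^ 3 * hP9
    rw [← h4, h3]
  obtain rfl : θ = P := by linear_combination θ * hP4 - P * e1
  clear hπ hπ9 hπ3 h hm hr hw hk hl hm9 ha hx ha' hx' e1 hθ hθ9
  have hQ' : θ ^ 3 * Q = 1 - θ ^ 3 - w ^ 3 := by
    have : θ * Q ^ 3 = 1 - θ - w := by grind
    calc θ ^ 3 * Q = (θ * Q ^ 3) ^ 3 := by rw [mul_pow, ← pow_mul, hQ9]
      _ = 1 - θ ^ 3 - w ^ 3 := by rw [this, sub_cube, sub_cube, one_pow]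
  have hR' : θ ^ 3 * R = Q ^ 3 - θ ^ 3 - k ^ 3 - w ^ 3 + w ^ 3 * θ ^ 3 - (w ^ 3) ^ 2 := by
    have : θ * R ^ 3 = Q - θ - k - w + w * θ - w ^ 2 := by grind
    calc θ ^ 3 * R = (θ * R ^ 3) ^ 3 := by rw [mul_pow, ← pow_mul, hR9]
      _ = Q ^ 3 - θ ^ 3 - k ^ 3 - w ^ 3 + w ^ 3 * θ ^ 3 - (w ^ 3) ^ 2 := by
        rw [this]; simp only [sub_cube, add_cube, mul_pow, pow_right_comm w 2]
  have hw3' : w ^ 3 = -1 - w := by linear_combination hw3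
  have hQ1 : Q = θ - w * θ - 1 := by
    rw [hw3'] at hQ'
    linear_combination Q * hP4 - θ * hQ' + hP4 - θ * h3
  have hQ3 : Q ^ 3 = θ ^ 3 - w ^ 3 * θ ^ 3 - 1 := by
    rw [hQ1, sub_cube, sub_cube, mul_pow, one_pow]
  have hR1 : R = θ * (1 + k ^ 3 + w + w ^ 2) := by
    rw [hQ3, hw3'] at hR'
    clear hQ hR hP hQ' hw3 hw3' e2 e3 hQ1 hQ3 hP9 hQ9 hR9 hr9 hk9 hl9 hw9
    grind
  refine quadratic_obstruction hP4 hw3 hw9 hr9 (k := k) (by linear_combination hP) ?_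
  have h1 : w - k - θ + w * θ = r * l := by linear_combination -hQ + hQ1
  have h2 : k ^ 2 - w - θ * (1 + k ^ 3 + w + w ^ 2) = l ^ 2 := by linear_combination -hR + hR1
  rw [h1, h2, mul_pow]

/-- The case where one factor has trace zero to the fixed field and the other one does not. -/
theorem trace_zero_obstruction {b a x : F} (hb : b ^ 4 = -1) (ha0 : a ≠ 0)
    (ha : a + a ^ 9 + a ^ 81 = 0) (hx : x ^ 729 = x) (hX : x + x ^ 9 + x ^ 81 ≠ 0) :
    (x + x ^ 9 + x ^ 81) * a ^ 9 + (a * x) ^ 9 - a * x + b * (a * x) ^ 3 ≠ 0 := by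
  intro h
  have h3 : (3 : F) = 0 := by grind
  have hb9 : b ^ 9 = b := by linear_combination (b ^ 5 - b) * hb
  have ha' : (a ^ 9) ^ 9 = - a - a ^ 9 := by linear_combination ha
  obtain ⟨X, hXx⟩ : ∃ X, X = x + x ^ 9 + x ^ 81 := ⟨_, rfl⟩
  rw [← hXx] at hX h
  have hX9 : X ^ 9 = X := by
    rw [hXx, add_pow_nine, add_pow_nine]; linear_combination hx
  obtain ⟨t, ht⟩ : ∃ t, t = a * x := ⟨_, rfl⟩
  rw [← ht] at h
  have ha81 : a ^ 81 = -a - a ^ 9 := by linear_combination ha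
  have ha729 : a ^ 729 = a := by
    rw [show 729 = 81 * 9 by rfl, pow_mul, ha81, sub_pow_nine, neg_pow, ha']; ring
  have ht729 : t ^ 729 = t := by rw [ht, mul_pow, ha729, hx]
  have h9 : X * a ^ 81 + t ^ 81 - t ^ 9 + b * (t ^ 9) ^ 3 = 0 := by
    have e := congrArg (· ^ 9) h
    simp only [add_pow_nine, sub_pow_nine, mul_pow, hX9, hb9] at e
    linear_combination e
  have h81 : X * a + t - t ^ 81 + b * (t ^ 81) ^ 3 = 0 := by
    have e := congrArg (· ^ 9) h9
    simp only [add_pow_nine, sub_pow_nine, mul_pow, hX9, hb9] at e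
    linear_combination e - X * ha729 - ht729
  have hb0 : b ≠ 0 := by rintro rfl; simp at hb
  have htr : t + t ^ 9 + t ^ 81 = 0 := by
    have h1 : b * (t + t ^ 9 + t ^ 81) ^ 3 = 0 := by
      rw [add_cube, add_cube]; linear_combination h + h9 + h81 - X * ha
    simpa [hb0] using h1
  obtain ⟨r, hr⟩ : ∃ r, r = a ^ 9 - a := ⟨_, rfl⟩
  obtain ⟨s, hs⟩ : ∃ s, s = t ^ 9 - t := ⟨_, rfl⟩
  have hr9 : r ^ 9 = r := by rw [hr, sub_pow_nine, ha']; linear_combination -a ^ 9 * h3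
  have hs9 : s ^ 9 = s := by
    rw [hs, sub_pow_nine, ← pow_mul]; linear_combination htr - t ^ 9 * h3
  have ha9 : a ^ 9 = a + r := by rw [hr]; ring
  have ht9 : t ^ 9 = t + s := by rw [hs]; ring
  have h0 : X * (a + r) + s + b * t ^ 3 = 0 := by rw [hs, hr]; linear_combination h
  have hXr : X * r + b * s ^ 3 = 0 := by
    have h1 : X * (a + r + r) + s + b * (t ^ 3 + s ^ 3) = 0 := by
      rw [← add_cube, ← ht9]
      have e := congrArg (· ^ 9) h0
      simp only [add_pow_nine, mul_pow, hX9, hb9, hs9, hr9, ha9] at e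
      linear_combination e
    linear_combination h1 - h0
  have hN : X * (a * (a + r) * (a - r)) = r * (s * a - t * r) := by
    have h1 : (a + r) * x ^ 9 = t + s := by rw [← ha9, ← ht9, ht, mul_pow]
    have h2 : (a - r) * x ^ 81 = t - s := by
      have e1 : a - r = a ^ 81 := by rw [hr]; linear_combination a * h3 - ha
      have e2 : t - s = t ^ 81 := by rw [hs]; linear_combination t * h3 - htr
      rw [e1, e2, ht, mul_pow]
    rw [hXx]
    linear_combination -(a + r) * (a - r) * ht + a * (a - r) * h1 + a * (a + r) * h2 +
      (t * a ^ 2 - s * a * r) * h3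
  have hr0 : r ≠ 0 := by
    intro e
    simp [e, hX, ha0] at hN
  have hs0 : s ≠ 0 := by
    intro e
    simp [e, hX, hr0] at hXr
  clear h h9 h81 ht ha81 ha729 ht729 hXx hr hs ha ha' htr hx
  obtain ⟨z, rfl⟩ : ∃ z, a = r * z := ⟨a / r, by field_simp⟩
  obtain ⟨y, rfl⟩ : ∃ y, t = s * y := ⟨t / s, by field_simp⟩
  obtain ⟨g, hg⟩ : ∃ g, g * (b * s ^ 2) = 1 := ⟨(b * s ^ 2)⁻¹, by field_simp⟩
  have hz9 : z ^ 9 = z + 1 := by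
    rw [mul_pow, hr9] at ha9
    exact mul_left_cancel₀ hr0 (by linear_combination ha9)
  have hy9 : y ^ 9 = y + 1 := by
    rw [mul_pow, hs9] at ht9
    exact mul_left_cancel₀ hs0 (by linear_combination ht9)
  have hs8 : s ^ 8 = 1 := mul_left_cancel₀ hs0 (by linear_combination hs9)
  have hg4 : g ^ 4 = -1 := by
    have h1 : (g * (b * s ^ 2)) ^ 4 = -g ^ 4 := by
      linear_combination g ^ 4 * b ^ 4 * hs8 + g ^ 4 * hb
    rw [hg] at h1
    linear_combination h1
  have hzy : z = y ^ 3 + g - 1 := by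
    refine mul_left_cancel₀ (mul_ne_zero hb0 (pow_ne_zero 3 hs0)) ?_
    linear_combination (z + 1) * hXr - h0 - s * hg
  have hzz : z ^ 3 - z = -g * (z - y) := by
    have h1 : -(b * s ^ 2) * (z ^ 3 - z) = z - y := by
      refine mul_left_cancel₀ (mul_ne_zero (pow_ne_zero 2 hr0) hs0) ?_
      linear_combination hN - r ^ 2 * (z ^ 3 - z) * hXr
    linear_combination -g * h1 - (z ^ 3 - z) * hg
  have hy3 : y ^ 3 - y = (z - y) + 1 - g := by linear_combination -hzy
  refine linear_obstruction hg4 (k := z - y) (by rw [sub_pow_nine, hz9, hy9]; ring) ?_ ?_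
  · rw [sub_cube]; linear_combination hzz - hy3
  · rw [← hy3, sub_cube, ← pow_mul, hy9]; ring

/-- The linearized map attached to `b x ^ 30 + x ^ 10 + x ^ 2` has trivial kernel. -/
theorem eq_zero_of_linearized_eq_zero (hF : ∀ x : F, x ^ 729 = x) {b a x : F} (hb : b ^ 4 = -1)
    (ha : a ≠ 0)
    (h : b * (x ^ 27 * a ^ 3 + x ^ 3 * a ^ 27) + (x ^ 9 * a + x * a ^ 9) + 2 * (a * x) = 0) :
    x = 0 := by
  by_contra hx
  have h3 : (3 : F) = 0 := by grind
  obtain ⟨u, hu⟩ : ∃ u, u = x ^ 9 * a + x * a ^ 9 := ⟨_, rfl⟩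
  have hu3 : u ^ 3 = x ^ 27 * a ^ 3 + x ^ 3 * a ^ 27 := by rw [hu, add_cube]; ring
  have hu9 : u ^ 9 = x ^ 81 * a ^ 9 + x ^ 9 * a ^ 81 := by rw [hu, add_pow_nine]; ring
  rw [← hu3, ← hu] at h
  have ht : a * x = b * u ^ 3 + u := by linear_combination -h + a * x * h3
  have hE : (x + x ^ 9 + x ^ 81) * a ^ 9 + (a + a ^ 9 + a ^ 81) * x ^ 9 + (a * x) ^ 9 - a * x +
      b * (a * x) ^ 3 = 0 := by
    have h1 : (a * x) ^ 3 = b ^ 3 * u ^ 9 + u ^ 3 := by rw [ht, add_cube]; ring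
    rw [h1]
    linear_combination -hu9 - hu + x ^ 9 * a ^ 9 * h3 - ht + u ^ 9 * hb
  by_cases hS : a + a ^ 9 + a ^ 81 = 0 <;> by_cases hX : x + x ^ 9 + x ^ 81 = 0
  · rw [hS, hX] at hE
    have h1 : (a * x + b * (a * x) ^ 3) + b * (a * x + b * (a * x) ^ 3) ^ 3 = 0 := by
      rw [add_cube]
      linear_combination -hE + (a * x) ^ 9 * hb + b * (a * x) ^ 3 * h3
    have hinj : ∀ v : F, v + b * v ^ 3 = 0 → v = 0 := by
      intro v hv
      by_contra hv0
      have h2 : b * v ^ 2 = -1 := mul_left_cancel₀ hv0 (by linear_combination hv)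
      have h4 : v ^ 8 = -1 := by
        have : (b * v ^ 2) ^ 4 = 1 := by rw [h2]; norm_num
        linear_combination v ^ 8 * hb - this
      have h5 : v ^ 728 = 1 := mul_left_cancel₀ hv0 (by linear_combination hF v)
      have h6 : v ^ 728 = -1 := by
        rw [show 728 = 8 * 91 by rfl, pow_mul, h4]; norm_num
      have : (1 : F) = 0 := by linear_combination h3 + h5 - h6
      exact one_ne_zero this
    exact mul_ne_zero ha hx (hinj _ (hinj _ h1))
  · exact trace_zero_obstruction hb ha hS (hF x) hX (by rw [hS] at hE; linear_combination hE)
  · refine trace_zero_obstruction hb hx hX (hF a) hS ?_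
    rw [hX] at hE
    rw [mul_comm x a]
    linear_combination hE
  · obtain ⟨S, hSa⟩ : ∃ S, S = a + a ^ 9 + a ^ 81 := ⟨_, rfl⟩
    obtain ⟨X, hXx⟩ : ∃ X, X = x + x ^ 9 + x ^ 81 := ⟨_, rfl⟩
    have hS9 : S ^ 9 = S := by
      rw [hSa, add_pow_nine, add_pow_nine]; linear_combination hF a
    have hX9 : X ^ 9 = X := by
      rw [hXx, add_pow_nine, add_pow_nine]; linear_combination hF x
    rw [← hSa, ← hXx] at hE
    rw [← hSa] at hS
    rw [← hXx] at hX
    obtain ⟨c, rfl⟩ : ∃ c, a = S * c := ⟨a / S, by field_simp⟩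
    obtain ⟨z, rfl⟩ : ∃ z, x = X * z := ⟨x / X, by field_simp⟩
    have p81 {y : F} (hy : y ^ 9 = y) : y ^ 81 = y := by
      rw [show 81 = 9 * 9 by rfl, pow_mul, hy, hy]
    have p8 {y : F} (hy : y ^ 9 = y) (h0 : y ≠ 0) : y ^ 8 = 1 :=
      mul_left_cancel₀ h0 (by linear_combination hy)
    simp only [mul_pow, hS9, hX9, p81 hS9, p81 hX9] at hSa hXx hE
    refine trace_one_obstruction (θ := b * (S * X) ^ 2) (a := c) (x := z) ?_ ?_ ?_ ?_
    · rw [mul_pow, ← pow_mul, mul_pow, p8 hS9 hS, p8 hX9 hX, hb]; ring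
    · exact mul_left_cancel₀ hS (by linear_combination -hSa)
    · exact mul_left_cancel₀ hX (by linear_combination -hXx)
    · refine mul_left_cancel₀ (mul_ne_zero hS hX) ?_
      linear_combination hE

end CharThree

/-- For `α` a primitive element of `F_{3^6}` (so `α^91` is a primitive element of the
subfield `F_{3^2}`), the trinomial `α^91 x^30 + x^10 + x^2` is planar over `F_{3^6}`. -/
theorem new_trinomial_planar_dim6 (α : GaloisField 3 6)
    (hα : orderOf α = 3 ^ 6 - 1) :
    ∀ a : GaloisField 3 6, a ≠ 0 →
      Function.Bijective
        (fun x : GaloisField 3 6 =>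
          (α ^ 91 * (x + a) ^ 30 + (x + a) ^ 10 + (x + a) ^ 2)
            - (α ^ 91 * x ^ 30 + x ^ 10 + x ^ 2)) := by
  intro a ha
  have hF : ∀ x : GaloisField 3 6, x ^ 729 = x := by
    intro x
    let := Fintype.ofFinite (GaloisField 3 6)
    have := FiniteField.pow_card x
    rwa [← Nat.card_eq_fintype_card, GaloisField.card 3 6 (by norm_num)] at this
  have hb : (α ^ 91) ^ 4 = -1 := by
    have h1 : (α ^ 364) ^ 2 = 1 := by
      rw [← pow_mul, ← orderOf_dvd_iff_pow_eq_one, hα]; norm_num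
    have h2 : α ^ 364 ≠ 1 := by
      rw [Ne, ← orderOf_dvd_iff_pow_eq_one, hα]; norm_num
    rw [← pow_mul]
    exact (mul_self_eq_one_iff.1 (by rwa [← sq])).resolve_left h2
  refine Finite.injective_iff_bijective.1 fun x y hxy ↦ ?_
  refine sub_eq_zero.1 (eq_zero_of_linearized_eq_zero hF hb ha ?_)
  have e10 (z : GaloisField 3 6) : z ^ 10 = z ^ 9 * z := by ring
  have e30 (z : GaloisField 3 6) : z ^ 30 = (z ^ 9) ^ 3 * z ^ 3 := by ring
  have e27 (z : GaloisField 3 6) : z ^ 27 = (z ^ 9) ^ 3 := by ring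
  simp only [e10, e30, add_pow_nine, add_cube] at hxy
  simp only [e27, sub_pow_nine, sub_cube]
  linear_combination hxy
end

section
/- Over F_{3^9}, the pentanomial F(x) = x^{756} + x^{486} + x^{162} + x^6 + x^2 (coefficients in F_3) is planar. -/
/-! ### The quadratic form and its polarization in characteristic three -/

section Form

variable {S : Type*} [CommRing S]

/-- The pentanomial `x^756 + x^486 + x^162 + x^6 + x^2`. -/
def pentanomial (x : S) : S := x ^ 756 + x ^ 486 + x ^ 162 + x ^ 6 + x ^ 2

/-- The polarization of `pentanomial` in characteristic three. -/
def pentanomialPolar (x y : S) : S :=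
  x ^ 729 * y ^ 27 + x ^ 27 * y ^ 729 +
    2 * (x ^ 243 * y ^ 243 + x ^ 81 * y ^ 81 + x ^ 3 * y ^ 3 + x * y)

theorem pentanomial_neg (x : S) : pentanomial (-x) = pentanomial x := by
  simp only [pentanomial, (by decide : Even 756).neg_pow, (by decide : Even 486).neg_pow,
    (by decide : Even 162).neg_pow, (by decide : Even 6).neg_pow, (by decide : Even 2).neg_pow]

theorem pentanomial_eq (x : S) : pentanomial x =
    x ^ 729 * x ^ 27 + (x ^ 243) ^ 2 + (x ^ 81) ^ 2 + (x ^ 3) ^ 2 + x ^ 2 := by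
  simp only [pentanomial, ← pow_add, ← pow_mul]

theorem pentanomialPolar_neg_left (x y : S) :
    pentanomialPolar (-x) y = -pentanomialPolar x y := by
  simp only [pentanomialPolar, (by decide : Odd 729).neg_pow, (by decide : Odd 243).neg_pow,
    (by decide : Odd 81).neg_pow, (by decide : Odd 27).neg_pow, (by decide : Odd 3).neg_pow]
  ring

theorem pentanomialPolar_neg_right (x y : S) :
    pentanomialPolar x (-y) = -pentanomialPolar x y := by
  simp only [pentanomialPolar, (by decide : Odd 729).neg_pow, (by decide : Odd 243).neg_pow,
    (by decide : Odd 81).neg_pow, (by decide : Odd 27).neg_pow, (by decide : Odd 3).neg_pow]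
  ring

variable [CharP S 3]

theorem pentanomial_add (x y : S) :
    pentanomial (x + y) = pentanomial x + pentanomial y + pentanomialPolar x y := by
  have h (k : ℕ) : (x + y) ^ 3 ^ k = x ^ 3 ^ k + y ^ 3 ^ k := add_pow_char_pow x y 3 k
  have h1 := h 1
  have h3 := h 3
  have h4 := h 4
  have h5 := h 5
  have h6 := h 6
  norm_num only at h1 h3 h4 h5 h6
  simp only [pentanomial_eq, pentanomialPolar, h1, h3, h4, h5, h6]
  ring

theorem pentanomialPolar_add_left (x y z : S) :
    pentanomialPolar (x + y) z = pentanomialPolar x z + pentanomialPolar y z := by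
  have h (k : ℕ) : (x + y) ^ 3 ^ k = x ^ 3 ^ k + y ^ 3 ^ k := add_pow_char_pow x y 3 k
  have h1 := h 1
  have h3 := h 3
  have h4 := h 4
  have h5 := h 5
  have h6 := h 6
  norm_num only at h1 h3 h4 h5 h6
  simp only [pentanomialPolar, h1, h3, h4, h5, h6]
  ring

theorem three_eq_zero_of_charP : (3 : S) = 0 := by
  exact_mod_cast CharP.cast_eq_zero S 3

theorem natCast_mod_three (n : ℕ) : ((n % 3 : ℕ) : S) = n := by
  conv_rhs => rw [← Nat.div_add_mod n 3]
  push_cast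
  linear_combination (-(n / 3 : ℕ) : S) * three_eq_zero_of_charP (S := S)

end Form

/-! ### Coordinates in a tower of two Artin–Schreier extensions -/

/-- Coordinates with respect to the powers `1, θ, θ ^ 2`. -/
structure Triple (R : Type*) where
  x0 : R
  x1 : R
  x2 : R

namespace Triple

variable {R S : Type*} [CommRing S]

/-- Coordinatewise addition. -/
def add (a : R → R → R) (x y : Triple R) : Triple R :=
  ⟨a x.x0 y.x0, a x.x1 y.x1, a x.x2 y.x2⟩

/-- Multiplication modulo the relation `θ ^ 3 = θ + c`. -/
def mul (a m : R → R → R) (c : R) (x y : Triple R) : Triple R :=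
  let s := a (m x.x1 y.x2) (m x.x2 y.x1)
  let t := m x.x2 y.x2
  ⟨a (m x.x0 y.x0) (m c s), a (a (m x.x0 y.x1) (m x.x1 y.x0)) (a s (m c t)),
    a (a (m x.x0 y.x2) (m x.x1 y.x1)) (a (m x.x2 y.x0) t)⟩

/-- The element with the given coordinates. -/
def eval (φ : R → S) (θ : S) (x : Triple R) : S := φ x.x0 + φ x.x1 * θ + φ x.x2 * θ ^ 2

theorem eval_add {a : R → R → R} {φ : R → S} (ha : ∀ x y, φ (a x y) = φ x + φ y) (θ : S)
    (x y : Triple R) : eval φ θ (add a x y) = eval φ θ x + eval φ θ y := by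
  simp only [eval, add, ha]
  ring

theorem eval_mul {a m : R → R → R} {c : R} {φ : R → S} {θ : S}
    (ha : ∀ x y, φ (a x y) = φ x + φ y) (hm : ∀ x y, φ (m x y) = φ x * φ y)
    (hθ : θ ^ 3 = θ + φ c) (x y : Triple R) :
    eval φ θ (mul a m c x y) = eval φ θ x * eval φ θ y := by
  simp only [eval, mul, ha, hm]
  linear_combination (-(φ x.x1 * φ y.x2 + φ x.x2 * φ y.x1) - φ x.x2 * φ y.x2 * θ) * hθ

end Triple

/-- Coordinates in `F_27 = F_3(α)`, where `α ^ 3 = α + 1`; natural numbers stand for their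
residues modulo three. -/
abbrev Coords27 := Triple ℕ

/-- Coordinates in `F_27(β)`, where `β ^ 3 = β + α ^ 2`. -/
abbrev Coords := Triple Coords27

namespace Coords27

def add (x y : Coords27) : Coords27 := Triple.add Nat.add x y

def mul (x y : Coords27) : Coords27 := Triple.mul Nat.add (fun m n => m * n % 3) 1 x y

/-- The base-three number `x0 + 3 * x1 + 9 * x2 + 27 * n`, digits reduced modulo three. -/
def index (x : Coords27) (n : ℕ) : ℕ :=
  Nat.add (Nat.mod x.x0 3) (Nat.mul 3 (Nat.add (Nat.mod x.x1 3)
    (Nat.mul 3 (Nat.add (Nat.mod x.x2 3) (Nat.mul 3 n)))))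

theorem index_eq (x : Coords27) (n : ℕ) :
    x.index n = x.x0 % 3 + 3 * (x.x1 % 3 + 3 * (x.x2 % 3 + 3 * n)) := rfl

variable {S : Type*} [CommRing S] [CharP S 3]

theorem eval_eq_of_index_eq (α : S) {x y : Coords27} {m n : ℕ} (h : x.index m = y.index n) :
    m = n ∧ x.eval Nat.cast α = y.eval Nat.cast α := by
  rw [index_eq, index_eq] at h
  have key {a b : ℕ} (e : a % 3 = b % 3) : (a : S) = b := by
    rw [← natCast_mod_three a, e, natCast_mod_three]
  have h0 : x.x0 % 3 = y.x0 % 3 := by omega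
  have h1 : x.x1 % 3 = y.x1 % 3 := by omega
  have h2 : x.x2 % 3 = y.x2 % 3 := by omega
  exact ⟨by omega, by rw [Triple.eval, Triple.eval, key h0, key h1, key h2]⟩

theorem eval_add_eq_of_index_add_eq (α : S) {x y : Coords27} {m n k : ℕ}
    (h : x.index m + y.index n = 26 + 27 * k) :
    m + n = k ∧
      x.eval Nat.cast α + y.eval Nat.cast α = 2 * Triple.eval Nat.cast α ⟨1, 1, 1⟩ := by
  rw [index_eq, index_eq] at h
  have key {a b : ℕ} (e : a % 3 + b % 3 = 2) : (a : S) + b = 2 := by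
    rw [← natCast_mod_three a, ← natCast_mod_three b, ← Nat.cast_add, e, Nat.cast_ofNat]
  have h0 : x.x0 % 3 + y.x0 % 3 = 2 := by omega
  have h1 : x.x1 % 3 + y.x1 % 3 = 2 := by omega
  have h2 : x.x2 % 3 + y.x2 % 3 = 2 := by omega
  refine ⟨by omega, ?_⟩
  simp only [Triple.eval, Nat.cast_one]
  linear_combination key h0 + key h1 * α + key h2 * α ^ 2

end Coords27

namespace Coords

def add (x y : Coords) : Coords := Triple.add Coords27.add x y

def mul (x y : Coords) : Coords := Triple.mul Coords27.add Coords27.mul ⟨0, 0, 1⟩ x y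

def cube (x : Coords) : Coords := x.mul (x.mul x)

/-- `pentanomial` in coordinates. -/
def form (x : Coords) : Coords :=
  let x1 := x.cube
  let x3 := x1.cube.cube
  let x4 := x3.cube
  let x5 := x4.cube
  let x6 := x5.cube
  (x6.mul x3).add (((x5.mul x5).add (x4.mul x4)).add ((x1.mul x1).add (x.mul x)))

/-- `pentanomialPolar` in coordinates. -/
def polar (x y : Coords) : Coords :=
  let x1 := x.cube
  let x3 := x1.cube.cube
  let x4 := x3.cube
  let x5 := x4.cube
  let x6 := x5.cube
  let y1 := y.cube
  let y3 := y1.cube.cube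
  let y4 := y3.cube
  let y5 := y4.cube
  let y6 := y5.cube
  let z := ((x5.mul y5).add (x4.mul y4)).add ((x1.mul y1).add (x.mul y))
  ((x6.mul y3).add (x3.mul y6)).add (z.add z)

def ones : Coords := ⟨⟨1, 1, 1⟩, ⟨1, 1, 1⟩, ⟨1, 1, 1⟩⟩

def basis : List Coords :=
  [⟨⟨1, 0, 0⟩, ⟨0, 0, 0⟩, ⟨0, 0, 0⟩⟩, ⟨⟨0, 1, 0⟩, ⟨0, 0, 0⟩, ⟨0, 0, 0⟩⟩,
    ⟨⟨0, 0, 1⟩, ⟨0, 0, 0⟩, ⟨0, 0, 0⟩⟩, ⟨⟨0, 0, 0⟩, ⟨1, 0, 0⟩, ⟨0, 0, 0⟩⟩,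
    ⟨⟨0, 0, 0⟩, ⟨0, 1, 0⟩, ⟨0, 0, 0⟩⟩, ⟨⟨0, 0, 0⟩, ⟨0, 0, 1⟩, ⟨0, 0, 0⟩⟩,
    ⟨⟨0, 0, 0⟩, ⟨0, 0, 0⟩, ⟨1, 0, 0⟩⟩, ⟨⟨0, 0, 0⟩, ⟨0, 0, 0⟩, ⟨0, 1, 0⟩⟩,
    ⟨⟨0, 0, 0⟩, ⟨0, 0, 0⟩, ⟨0, 0, 1⟩⟩]

/-- The base-three number whose digits are the coordinates modulo three. -/
def index (x : Coords) : ℕ := x.x0.index (x.x1.index (x.x2.index 0))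

/-- The bit set consisting of the indices of `x` and of `2 * ones - x`. -/
def bits (x : Coords) : ℕ :=
  Nat.lor (Nat.shiftLeft 1 x.index) (Nat.shiftLeft 1 (Nat.sub 19682 x.index))

/-- For each element of a list of vectors, its form and its polar pairings with all later ones. -/
def gram : List Coords → List (Coords × List Coords)
  | [] => []
  | e :: es => (form e, es.map (polar e)) :: gram es

/-- The bit set of all values of the form on `x + span es`, where `f` is the value at `x`, the list
`bs` holds the polar pairings of `x` with `es`, and the last argument is `gram es`. -/
def valuesOnCoset (f : Coords) : List Coords → List (Coords × List Coords) → ℕ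
  | b :: bs, (q, r) :: rows =>
    Nat.lor (valuesOnCoset f bs rows)
      (Nat.lor (valuesOnCoset (f.add (b.add q)) (List.zipWith add bs r) rows)
        (valuesOnCoset (f.add (b.add (b.add q)))
          (List.zipWith (fun u v => u.add (v.add v)) bs r) rows))
  | _, _ => f.bits

/-- The bit set of all values `ones ± form x`, with `x` in the span of a list of vectors with the
given Gram data. -/
def values : List (Coords × List Coords) → ℕ
  | (q, r) :: rows => Nat.lor (valuesOnCoset (q.add ones) r rows) (values rows)
  | [] => ones.bits

theorem values_gram_basis : Nat.beq (values (gram basis)) (Nat.sub (Nat.shiftLeft 1 19683) 1) =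
    true := by
  decide +kernel

theorem testBit_shiftLeft_sub_one {m n : ℕ} (hn : n < m) :
    (Nat.sub (Nat.shiftLeft 1 m) 1).testBit n = true := by
  have h : Nat.sub (Nat.shiftLeft 1 m) 1 = 2 ^ m - 1 := congrArg (· - 1) (Nat.one_shiftLeft m)
  rw [h, Nat.testBit_two_pow_sub_one, decide_eq_true hn]

theorem testBit_values_gram_basis {n : ℕ} (hn : n < 19683) :
    (values (gram basis)).testBit n = true := by
  rw [Nat.eq_of_beq_eq_true values_gram_basis]
  exact testBit_shiftLeft_sub_one hn

theorem testBit_bits {x : Coords} {n : ℕ} (h : x.bits.testBit n = true) :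
    x.index = n ∨ 19682 - x.index = n := by
  have h' : ((1 <<< x.index) ||| (1 <<< (19682 - x.index)) : ℕ).testBit n = true := h
  simpa [Nat.testBit_or, Nat.one_shiftLeft, Nat.testBit_two_pow] using h'

theorem index_lt (x : Coords) : x.index < 19683 := by
  simp only [index, Coords27.index_eq]
  omega

section Eval

variable {S : Type*} [CommRing S]

/-- The element with the given coordinates in the basis `α ^ i * β ^ j`. -/
def eval (α β : S) : Coords → S := Triple.eval (Triple.eval Nat.cast α) β

theorem eval_add (α β : S) (x y : Coords) : eval α β (x.add y) = eval α β x + eval α β y :=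
  Triple.eval_add (Triple.eval_add Nat.cast_add α) β x y

variable [CharP S 3]

theorem eval_eq_of_index_eq (α β : S) {x y : Coords} (h : x.index = y.index) :
    eval α β x = eval α β y := by
  obtain ⟨h, h0⟩ := Coords27.eval_eq_of_index_eq α h
  obtain ⟨h, h1⟩ := Coords27.eval_eq_of_index_eq α h
  obtain ⟨-, h2⟩ := Coords27.eval_eq_of_index_eq α h
  simp only [eval, Triple.eval] at h0 h1 h2 ⊢
  rw [h0, h1, h2]

theorem eval_add_eq_of_index_eq (α β : S) {x y : Coords} (h : 19682 - x.index = y.index) :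
    eval α β x + eval α β y = 2 * eval α β ones := by
  have h : x.index + y.index = 26 + 27 * (26 + 27 * (26 + 27 * 0)) := by
    have := x.index_lt
    omega
  obtain ⟨h, h0⟩ := Coords27.eval_add_eq_of_index_add_eq α h
  obtain ⟨h, h1⟩ := Coords27.eval_add_eq_of_index_add_eq α h
  obtain ⟨-, h2⟩ := Coords27.eval_add_eq_of_index_add_eq α h
  simp only [eval, Triple.eval, ones] at h0 h1 h2 ⊢
  linear_combination h0 + h1 * β + h2 * β ^ 2

variable {α β : S}

theorem eval_mul (hα : α ^ 3 = α + 1) (hβ : β ^ 3 = β + α ^ 2) (x y : Coords) :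
    eval α β (x.mul y) = eval α β x * eval α β y := by
  refine Triple.eval_mul (Triple.eval_add Nat.cast_add α) (Triple.eval_mul Nat.cast_add ?_ ?_)
    ?_ x y
  · intro m n
    rw [natCast_mod_three, Nat.cast_mul]
  · rw [hα, Nat.cast_one]
  · rw [hβ]
    simp [Triple.eval]

theorem eval_cube (hα : α ^ 3 = α + 1) (hβ : β ^ 3 = β + α ^ 2) (x : Coords) :
    eval α β x.cube = eval α β x ^ 3 := by
  rw [cube, eval_mul hα hβ, eval_mul hα hβ]
  ring

theorem eval_form (hα : α ^ 3 = α + 1) (hβ : β ^ 3 = β + α ^ 2) (x : Coords) :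
    eval α β x.form = pentanomial (eval α β x) := by
  simp only [form, eval_add, eval_mul hα hβ, eval_cube hα hβ, pentanomial_eq, ← pow_mul]
  ring

theorem eval_polar (hα : α ^ 3 = α + 1) (hβ : β ^ 3 = β + α ^ 2) (x y : Coords) :
    eval α β (x.polar y) = pentanomialPolar (eval α β x) (eval α β y) := by
  simp only [polar, eval_add, eval_mul hα hβ, eval_cube hα hβ, pentanomialPolar, ← pow_mul]
  ring

theorem exists_of_testBit_valuesOnCoset (hα : α ^ 3 = α + 1) (hβ : β ^ 3 = β + α ^ 2) {n : ℕ}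
    (es : List Coords) {bs : List Coords} {f : Coords} {x : S}
    (hf : eval α β f = pentanomial x + eval α β ones)
    (hbs : List.Forall₂ (fun b e => eval α β b = pentanomialPolar x (eval α β e)) bs es)
    (h : (valuesOnCoset f bs (gram es)).testBit n = true) :
    ∃ (g : Coords) (y : S), eval α β g = pentanomial y + eval α β ones ∧
      (g.index = n ∨ 19682 - g.index = n) := by
  have zip {P Q : Coords → Coords → Prop} {g : Coords → Coords → Coords} {k : Coords → Coords}
      (hPQ : ∀ b e, P b e → Q (g b (k e)) e) {bs es : List Coords} (hP : List.Forall₂ P bs es) :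
      List.Forall₂ Q (List.zipWith g bs (es.map k)) es := by
    induction hP with
    | nil => exact .nil
    | cons h _ ih => exact .cons (hPQ _ _ h) ih
  induction es generalizing bs f x with
  | nil =>
    obtain rfl := List.forall₂_nil_right_iff.mp hbs
    exact ⟨f, x, hf, testBit_bits h⟩
  | cons e es ih =>
    obtain ⟨b, bs, hb, hbs', rfl⟩ := List.forall₂_cons_right_iff.mp hbs
    have h' : (valuesOnCoset f bs (gram es) |||
        (valuesOnCoset (f.add (b.add (form e))) (List.zipWith add bs (es.map (polar e))) (gram es)
        ||| valuesOnCoset (f.add (b.add (b.add (form e))))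
          (List.zipWith (fun u v => u.add (v.add v)) bs (es.map (polar e))) (gram es))).testBit n
        = true := h
    simp only [Nat.testBit_or, Bool.or_eq_true] at h'
    rcases h' with h' | h' | h'
    · exact ih hf hbs' h'
    · refine ih (x := x + eval α β e) ?_ (zip (fun b' e' hb' => ?_) hbs') h'
      · rw [eval_add, eval_add, eval_form hα hβ, hf, hb, pentanomial_add]
        ring
      · rw [eval_add, eval_polar hα hβ, hb', pentanomialPolar_add_left]
    · refine ih (x := x + -eval α β e) ?_ (zip (fun b' e' hb' => ?_) hbs') h'
      · rw [eval_add, eval_add, eval_add, eval_form hα hβ, hf, hb, pentanomial_add,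
          pentanomialPolar_neg_right, pentanomial_neg]
        linear_combination
          pentanomialPolar x (eval α β e) * three_eq_zero_of_charP (S := S)
      · rw [eval_add, eval_add, eval_polar hα hβ, hb', pentanomialPolar_add_left,
          pentanomialPolar_neg_left]
        linear_combination
          pentanomialPolar (eval α β e) (eval α β e') * three_eq_zero_of_charP (S := S)

theorem exists_of_testBit_values (hα : α ^ 3 = α + 1) (hβ : β ^ 3 = β + α ^ 2) {n : ℕ}
    (es : List Coords) (h : (values (gram es)).testBit n = true) :
    ∃ (g : Coords) (y : S), eval α β g = pentanomial y + eval α β ones ∧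
      (g.index = n ∨ 19682 - g.index = n) := by
  induction es with
  | nil => exact ⟨ones, 0, by simp [pentanomial], testBit_bits h⟩
  | cons e es ih =>
    have h' : (valuesOnCoset (e.form.add ones) (es.map (polar e)) (gram es) |||
        values (gram es)).testBit n = true := h
    simp only [Nat.testBit_or, Bool.or_eq_true] at h'
    rcases h' with h' | h'
    · refine exists_of_testBit_valuesOnCoset hα hβ es (x := eval α β e) ?_ ?_ h'
      · rw [eval_add, eval_form hα hβ]
      · rw [List.forall₂_map_left_iff, List.forall₂_same]
        exact fun e' _ => eval_polar hα hβ e e'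
    · exact ih h'

theorem exists_pentanomial_eq_or_neg_eq (hα : α ^ 3 = α + 1) (hβ : β ^ 3 = β + α ^ 2)
    (hs : Function.Surjective (eval α β)) (y : S) :
    ∃ x, pentanomial x = y ∨ -pentanomial x = y := by
  obtain ⟨w, hw⟩ := hs (y + eval α β ones)
  obtain ⟨g, x, hg, h | h⟩ :=
    exists_of_testBit_values hα hβ basis (testBit_values_gram_basis w.index_lt)
  · exact ⟨x, .inl (by linear_combination eval_eq_of_index_eq α β h - hg + hw)⟩
  · exact ⟨x, .inr (by linear_combination hg - eval_add_eq_of_index_eq α β h + hw)⟩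

end Eval

end Coords

/-! ### The tower inside the field with `3 ^ 9` elements -/

section Tower

theorem pow_three_pow_of_artinSchreier {S : Type*} [CommRing S] [CharP S 3] {x c : S}
    (h : x ^ 3 = x + c) (k : ℕ) : x ^ 3 ^ k = x + ∑ i ∈ Finset.range k, c ^ 3 ^ i := by
  induction k with
  | zero => simp
  | succ k ih =>
    rw [pow_succ', pow_mul, h, add_pow_char_pow, ih, Finset.sum_range_succ]
    ring

theorem exists_artinSchreier_root {K : Type*} [Field K] [Fintype K] [CharP K 3] {k : ℕ}
    (hK : Fintype.card K = 3 ^ k) {c : K} (hc : ∑ i ∈ Finset.range k, c ^ 3 ^ i = 0) :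
    ∃ x : K, x ^ 3 = x + c := by
  let E := AlgebraicClosure K
  have : CharP E 3 := charP_of_injective_algebraMap (algebraMap K E).injective 3
  obtain ⟨γ, hγ⟩ := IsAlgClosed.exists_root
    (Polynomial.X ^ 3 - Polynomial.X - Polynomial.C (algebraMap K E c)) (by
      have : (Polynomial.X ^ 3 - Polynomial.X - Polynomial.C (algebraMap K E c)).degree = 3 := by
        compute_degree!
      rw [this]
      decide)
  have hγ3 : γ ^ 3 = γ + algebraMap K E c := by
    simp only [Polynomial.IsRoot, Polynomial.eval_sub, Polynomial.eval_pow, Polynomial.eval_X,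
      Polynomial.eval_C] at hγ
    linear_combination hγ
  have hγq : γ ^ Fintype.card K = γ := by
    rw [hK, pow_three_pow_of_artinSchreier hγ3]
    simp only [← map_pow, ← map_sum, hc, map_zero, add_zero]
  have hs : (Polynomial.X ^ Fintype.card K - Polynomial.X : Polynomial K).Splits := by
    simpa using (FiniteField.isSplittingField_sub K K).splits
  obtain ⟨a, ha⟩ := hs.mem_range_of_isRoot
    (FiniteField.X_pow_card_sub_X_ne_zero K Fintype.one_lt_card) (i := algebraMap K E) (x := γ)
    (by simp [Polynomial.IsRoot, hγq])
  refine ⟨a, (algebraMap K E).injective ?_⟩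
  rw [map_pow, map_add, ha, hγ3]

theorem eq_zero_of_fixed_of_add_mul_add_mul_sq {K : Type*} [Field K] (h2 : (2 : K) ≠ 0)
    (φ : K →+* K) {θ k u v w : K} (hθ : φ θ = θ + k) (hφk : φ k = k) (hk : k ≠ 0)
    (hu : φ u = u) (hv : φ v = v) (hw : φ w = w) (h : u + v * θ + w * θ ^ 2 = 0) :
    u = 0 ∧ v = 0 ∧ w = 0 := by
  have h1 := congrArg φ h
  simp only [map_add, map_mul, map_pow, hθ, hu, hv, hw, map_zero] at h1
  have hd : v + 2 * w * θ + w * k = 0 := by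
    apply (mul_eq_zero.mp (_ : k * _ = 0)).resolve_left hk
    linear_combination h1 - h
  have h3 := congrArg φ hd
  simp only [map_add, map_mul, hθ, hφk, hv, hw, map_zero, map_ofNat] at h3
  have hw0 : w = 0 := by
    apply (mul_eq_zero.mp (_ : (2 * k) * w = 0)).resolve_left (mul_ne_zero h2 hk)
    linear_combination h3 - hd
  subst hw0
  have hv0 : v = 0 := by linear_combination hd
  subst hv0
  exact ⟨by linear_combination h, rfl, rfl⟩

theorem surjective_eval {K : Type*} [Field K] [Algebra (ZMod 3) K]
    (hK : Module.finrank (ZMod 3) K = 9) {α β : K} (hα : α ^ 3 = α + 1)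
    (hβ : β ^ 3 = β + α ^ 2) : Function.Surjective (Coords.eval α β) := by
  have : CharP K 3 := charP_of_injective_algebraMap (algebraMap (ZMod 3) K).injective 3
  have three : (3 : K) = 0 := three_eq_zero_of_charP
  have h2 : (2 : K) ≠ 0 := fun h => one_ne_zero (α := K) (by linear_combination three - h)
  have hfix (c : ZMod 3) (k : ℕ) : algebraMap (ZMod 3) K c ^ 3 ^ k = algebraMap (ZMod 3) K c := by
    rw [← map_pow, ZMod.pow_card_pow]
  let γ (c : Fin 3 → ZMod 3) : K := algebraMap _ K (c 0) + algebraMap _ K (c 1) * α +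
    algebraMap _ K (c 2) * α ^ 2
  have hα27 : α ^ 3 ^ 3 = α := by
    rw [pow_three_pow_of_artinSchreier hα]
    simp
    linear_combination three
  have hβ27 : β ^ 3 ^ 3 = β + -1 := by
    have hα9 : α ^ 9 = α + 2 := by
      rw [show α ^ 9 = α ^ 3 ^ 2 by norm_num, pow_three_pow_of_artinSchreier hα]
      simp
    rw [pow_three_pow_of_artinSchreier hβ]
    simp only [Finset.sum_range_succ, Finset.sum_range_zero, ← pow_mul]
    norm_num
    rw [show α ^ 6 = (α ^ 3) ^ 2 by ring, show α ^ 18 = (α ^ 9) ^ 2 by ring, hα, hα9]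
    linear_combination (α ^ 2 + 2 * α + 2) * three
  have hγ27 (c : Fin 3 → ZMod 3) : γ c ^ 3 ^ 3 = γ c := by
    simp only [γ, add_pow_char_pow, mul_pow, hfix, pow_right_comm α 2, hα27]
  have hγ0 {c : Fin 3 → ZMod 3} (h : γ c = 0) : c = 0 := by
    obtain ⟨h0, h1, h2⟩ := eq_zero_of_fixed_of_add_mul_add_mul_sq h2 (frobenius K 3)
      (by rw [frobenius_def, hα]) (map_one _) one_ne_zero
      (hfix (c 0) 1) (hfix (c 1) 1) (hfix (c 2) 1) h
    ext i
    fin_cases i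
    exacts [(map_eq_zero _).mp h0, (map_eq_zero _).mp h1, (map_eq_zero _).mp h2]
  let Φ : (Fin 3 → Fin 3 → ZMod 3) →ₗ[ZMod 3] K :=
    { toFun := fun c => γ (c 0) + γ (c 1) * β + γ (c 2) * β ^ 2
      map_add' := fun c d => by simp only [γ, Pi.add_apply, map_add]; ring
      map_smul' := fun r c => by
        simp only [γ, Pi.smul_apply, smul_eq_mul, map_mul, RingHom.id_apply,
          Algebra.smul_def r (_ : K)]
        ring }
  have hΦ : Function.Injective Φ := by
    rw [injective_iff_map_eq_zero]
    intro c hc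
    obtain ⟨h0, h1, h2⟩ := eq_zero_of_fixed_of_add_mul_add_mul_sq h2 (iterateFrobenius K 3 3)
      (by rw [iterateFrobenius_def, hβ27]) (by simp) (by simp)
      (by rw [iterateFrobenius_def, hγ27]) (by rw [iterateFrobenius_def, hγ27])
      (by rw [iterateFrobenius_def, hγ27]) hc
    have h0 := hγ0 h0
    have h1 := hγ0 h1
    have h2 := hγ0 h2
    ext i : 1
    fin_cases i <;> assumption
  have : FiniteDimensional (ZMod 3) K := Module.finite_of_finrank_eq_succ hK
  have hΦs : Function.Surjective Φ :=
    (LinearMap.injective_iff_surjective_of_finrank_eq_finrank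
      (by simp [hK, Module.finrank_pi_fintype])).mp hΦ
  intro y
  obtain ⟨c, rfl⟩ := hΦs y
  have hcast (a : ZMod 3) : ((a.val : ℕ) : K) = algebraMap (ZMod 3) K a := by
    rw [← map_natCast (algebraMap (ZMod 3) K), ZMod.natCast_zmod_val]
  refine ⟨⟨⟨(c 0 0).val, (c 0 1).val, (c 0 2).val⟩, ⟨(c 1 0).val, (c 1 1).val, (c 1 2).val⟩,
    ⟨(c 2 0).val, (c 2 1).val, (c 2 2).val⟩⟩, ?_⟩
  simp only [Coords.eval, Triple.eval, hcast]
  rfl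

theorem exists_tower {K : Type*} [Field K] [Fintype K] [CharP K 3]
    (hK : Fintype.card K = 3 ^ 9) : ∃ α β : K, α ^ 3 = α + 1 ∧ β ^ 3 = β + α ^ 2 := by
  have three : (3 : K) = 0 := three_eq_zero_of_charP
  obtain ⟨α, hα⟩ := exists_artinSchreier_root hK (c := 1) (by
    simp only [one_pow, Finset.sum_const, Finset.card_range, nsmul_eq_mul, mul_one]
    push_cast
    linear_combination 3 * three)
  have hα' (i : ℕ) : (α ^ 2) ^ 3 ^ i = (α + i) ^ 2 := by
    rw [pow_right_comm, pow_three_pow_of_artinSchreier hα]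
    simp
  obtain ⟨β, hβ⟩ := exists_artinSchreier_root hK (c := α ^ 2) (by
    simp only [hα', Finset.sum_range_succ, Finset.sum_range_zero]
    push_cast
    linear_combination (3 * α ^ 2 + 24 * α + 68) * three)
  exact ⟨α, β, hα, hβ⟩

end Tower

/-- If `-1` is not a square in a finite field `K`, then an even function on `K` that vanishes at `0`
and takes every value up to sign takes each value at one pair `±x` at most. -/
theorem eq_or_eq_neg_of_even_of_surjective_up_to_sign {K : Type*} [Field K] [Fintype K]
    (hK : ¬IsSquare (-1 : K)) {F : K → K} (hF0 : F 0 = 0) (hF : ∀ x, F (-x) = F x)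
    (hs : ∀ y, ∃ x, F x = y ∨ -F x = y) {x y : K} (hxy : F x = F y) : x = y ∨ x = -y := by
  classical
  let h (x : K) : K := quadraticChar K x • F x
  have h_neg (x : K) : h (-x) = -h x := by
    have hχ : quadraticChar K (-x) = -quadraticChar K x := by
      rw [← neg_one_mul x, map_mul, quadraticChar_neg_one_iff_not_isSquare.mpr hK, neg_one_mul]
    simp only [h, hF, hχ, neg_smul]
  have h_eq {x : K} (hx : x ≠ 0) : h x = F x ∨ h (-x) = F x := by
    rcases quadraticChar_dichotomy hx with hχ | hχ
    · exact .inl (by simp only [h, hχ, one_smul])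
    · exact .inr (by simp only [h_neg, h, hχ, neg_smul, one_smul, neg_neg])
  have h_zero : h 0 = 0 := by simp only [h, hF0, smul_zero]
  have h_surj : Function.Surjective h := by
    intro y
    obtain ⟨x, hx⟩ := hs y
    by_cases hx0 : x = 0
    · subst hx0
      exact ⟨0, by simpa [hF0, h_zero] using hx⟩
    · rcases h_eq hx0 with e | e <;> rcases hx with rfl | rfl
      · exact ⟨x, e⟩
      · exact ⟨-x, by rw [h_neg, e]⟩
      · exact ⟨-x, e⟩
      · exact ⟨x, by rw [← e, h_neg, neg_neg]⟩
  have h_inj : Function.Injective h := Finite.injective_iff_surjective.mpr h_surj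
  have eq_zero {z : K} (hz : F z = 0) : z = 0 :=
    h_inj (by simp only [h_zero, h, hz, smul_zero])
  by_cases hx : x = 0
  · exact .inl (hx.trans (eq_zero (by rw [← hxy, hx, hF0])).symm)
  by_cases hy : y = 0
  · exact .inl ((eq_zero (by rw [hxy, hy, hF0])).trans hy.symm)
  rcases h_eq hx with e | e <;> rcases h_eq hy with e' | e' <;> rw [hxy, ← e'] at e <;>
    have := h_inj e
  · exact .inl this
  · exact .inr this
  · exact .inr (neg_eq_iff_eq_neg.mp this)
  · exact .inl (neg_injective this)

theorem pentanomial_eq_iff {K : Type*} [Field K] [Fintype K] [Algebra (ZMod 3) K]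
    (hK : Fintype.card K = 3 ^ 9) {x y : K} (h : pentanomial x = pentanomial y) :
    x = y ∨ x = -y := by
  have : CharP K 3 := charP_of_injective_algebraMap (algebraMap (ZMod 3) K).injective 3
  have hr : Module.finrank (ZMod 3) K = 9 := by
    rw [Module.card_eq_pow_finrank (K := ZMod 3), ZMod.card] at hK
    exact Nat.pow_right_injective (by norm_num : 2 ≤ 3) hK
  obtain ⟨α, β, hα, hβ⟩ := exists_tower hK
  refine eq_or_eq_neg_of_even_of_surjective_up_to_sign ?_ (by simp [pentanomial])
    pentanomial_neg (Coords.exists_pentanomial_eq_or_neg_eq hα hβ (surjective_eval hr hα hβ)) h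
  rw [FiniteField.isSquare_neg_one_iff, hK]
  decide

/-- The pentanomial `x^756 + x^486 + x^162 + x^6 + x^2` is planar over `F_{3^9}`. -/
theorem pentanomial_planar_dim9 :
    ∀ a : GaloisField 3 9, a ≠ 0 →
      Function.Bijective
        (fun x : GaloisField 3 9 =>
          ((x + a) ^ 756 + (x + a) ^ 486 + (x + a) ^ 162 + (x + a) ^ 6 + (x + a) ^ 2)
            - (x ^ 756 + x ^ 486 + x ^ 162 + x ^ 6 + x ^ 2)) := by
  intro a ha
  have := Fintype.ofFinite (GaloisField 3 9)
  have hK : Fintype.card (GaloisField 3 9) = 3 ^ 9 := by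
    rw [← Nat.card_eq_fintype_card, GaloisField.card 3 9 (by decide)]
  rw [← Finite.injective_iff_bijective]
  intro x y hxy
  replace hxy : pentanomial (x + a) - pentanomial x = pentanomial (y + a) - pentanomial y := hxy
  have hpolar : pentanomialPolar (x - y) a = 0 := by
    rw [pentanomial_add, pentanomial_add] at hxy
    rw [sub_eq_add_neg, pentanomialPolar_add_left, pentanomialPolar_neg_left]
    linear_combination hxy
  have h : pentanomial (x - y + a) = pentanomial (x - y + -a) := by
    rw [pentanomial_add, pentanomial_add, pentanomialPolar_neg_right, pentanomial_neg, hpolar,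
      neg_zero]
  have three : (3 : GaloisField 3 9) = 0 := three_eq_zero_of_charP
  rcases pentanomial_eq_iff hK h with h | h
  · exact absurd (by linear_combination a * three - h) ha
  · linear_combination (x - y) * three - h
end
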